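/- Fix 0 < q < 1 and θ = π/4, and set ε(u) = −2 (θ1(θ)/θ1(2θ))² · θ1(u)²/(θ1(u−θ)θ1(u+θ)). Then for every u ∈ ℂ such that θ1(u+jθ) ≠ 0 for j = −1, 0, 1, 2, 3: the sum of the single-particle excitation energies over an exact 4-string with centre u is ε(u) + ε(u+θ) + ε(u+2θ) + ε(u+3θ) = −4, independently of u. -/

import Mathlib

/-- The Jacobi theta function `θ₁(u,q) = −i Σ_{j∈ℤ} (−1)^j q^{(j+1/2)²} e^{(2j+1)iu}`. -/
noncomputable def th1 (q u : ℂ) : ℂ :=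
  -Complex.I * ∑' j : ℤ, (-1 : ℂ) ^ j * q ^ (((j : ℂ) + 1 / 2) ^ 2) *
    Complex.exp ((2 * (j : ℂ) + 1) * Complex.I * u)

/-- The Jacobi theta function `θ₄(u,q) = Σ_{j∈ℤ} (−1)^j q^{j²} e^{2iju}`. -/
noncomputable def th4 (q u : ℂ) : ℂ :=
  ∑' j : ℤ, (-1 : ℂ) ^ j * q ^ ((j : ℂ) ^ 2) * Complex.exp (2 * (j : ℂ) * Complex.I * u)

/-- `θ = π/4`. -/
noncomputable def thet : ℂ := (Real.pi : ℂ) / 4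

/-- The single-particle excitation energy of the staggered M₂ model. -/
noncomputable def eps (q u : ℂ) : ℂ :=
  -2 * (th1 q thet / th1 q (2 * thet)) ^ 2 * th1 q u ^ 2 /
    (th1 q (u - thet) * th1 q (u + thet))

open Complex in
lemma summable_cexp_quadratic {L : ℝ} (hL : L < 0) (w c : ℂ) :
    Summable fun j : ℤ ↦ exp (L * (j : ℂ) ^ 2 + w * j + c) := by
  have hπ : (Real.pi : ℂ) ≠ 0 := by exact_mod_cast Real.pi_ne_zero
  have hτ : 0 < (((-L / Real.pi : ℝ) : ℂ) * I).im := by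
    simpa using div_pos (neg_pos.2 hL) Real.pi_pos
  refine (((summable_jacobiTheta₂_term_iff (w / (2 * Real.pi * I)) _).2 hτ).mul_left
    (exp c)).congr fun j ↦ ?_
  rw [jacobiTheta₂_term, ← exp_add]
  congr 1
  push_cast
  field_simp
  linear_combination (-(L : ℂ) * j ^ 2) * I_sq

lemma ofReal_cpow_eq_cexp {q : ℝ} (hq : 0 < q) (z : ℂ) :
    (q : ℂ) ^ z = Complex.exp (Real.log q * z) := by
  rw [Complex.cpow_def_of_ne_zero (by exact_mod_cast hq.ne'), Complex.ofReal_log hq.le]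

/-- The theta function `θ₃(x, q²)`, with `L = log q`. -/
noncomputable def thetaThreeSq (L : ℝ) (x : ℂ) : ℂ :=
  ∑' r : ℤ, Complex.exp (2 * L * (r : ℂ) ^ 2 + 2 * r * Complex.I * x)

/-- The theta function `θ₂(x, q²)`, with `L = log q`. -/
noncomputable def thetaTwoSq (L : ℝ) (x : ℂ) : ℂ :=
  ∑' s : ℤ, Complex.exp (2 * L * ((s : ℂ) + 1 / 2) ^ 2 + (2 * s + 1) * Complex.I * x)

lemma summable_thetaThreeSq {L : ℝ} (hL : L < 0) (x : ℂ) : Summable fun r : ℤ ↦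
    Complex.exp (2 * L * (r : ℂ) ^ 2 + 2 * r * Complex.I * x) := by
  refine (summable_cexp_quadratic (L := 2 * L) (by linarith) (2 * Complex.I * x) 0).congr
    fun j ↦ ?_
  congr 1
  push_cast
  ring

lemma summable_thetaTwoSq {L : ℝ} (hL : L < 0) (x : ℂ) : Summable fun s : ℤ ↦
    Complex.exp (2 * L * ((s : ℂ) + 1 / 2) ^ 2 + (2 * s + 1) * Complex.I * x) := by
  refine (summable_cexp_quadratic (L := 2 * L) (by linarith) (2 * L + 2 * Complex.I * x)
    (L / 2 + Complex.I * x)).congr fun j ↦ ?_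
  congr 1
  push_cast
  ring

lemma summable_norm_thetaOne {L : ℝ} (hL : L < 0) (x : ℂ) : Summable fun j : ℤ ↦
    ‖(-1 : ℂ) ^ j * Complex.exp (L * ((j : ℂ) + 1 / 2) ^ 2 + (2 * j + 1) * Complex.I * x)‖ := by
  refine (summable_cexp_quadratic hL (L + 2 * Complex.I * x)
    (L / 4 + Complex.I * x)).norm.congr fun j ↦ ?_
  rw [norm_mul, norm_zpow, norm_neg, norm_one, one_zpow, one_mul]
  congr 2
  ring

lemma th1_eq_tsum_cexp {q : ℝ} (hq : 0 < q) (x : ℂ) :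
    th1 q x = -Complex.I * ∑' j : ℤ, (-1 : ℂ) ^ j *
      Complex.exp (Real.log q * ((j : ℂ) + 1 / 2) ^ 2 + (2 * j + 1) * Complex.I * x) := by
  simp only [th1, ofReal_cpow_eq_cexp hq, Complex.exp_add, mul_assoc]

lemma th1_mul_th1 {q : ℝ} (hq : 0 < q) (hq1 : q < 1) (x y : ℂ) :
    th1 q x * th1 q y =
      thetaThreeSq (Real.log q) (x + y) * thetaTwoSq (Real.log q) (x - y) -
        thetaTwoSq (Real.log q) (x + y) * thetaThreeSq (Real.log q) (x - y) := by
  have hL : Real.log q < 0 := Real.log_neg hq hq1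
  rw [th1_eq_tsum_cexp hq, th1_eq_tsum_cexp hq]
  set L := Real.log q
  set t : ℂ → ℤ → ℂ := fun x j ↦
    (-1 : ℂ) ^ j * Complex.exp (L * ((j : ℂ) + 1 / 2) ^ 2 + (2 * j + 1) * Complex.I * x)
  set F : ℤ × ℤ → ℂ := fun p ↦ t x p.1 * t y p.2
  let f : ℤ × ℤ → ℤ × ℤ := fun p ↦ (p.1 + p.2, p.1 - p.2 - 1)
  let g : ℤ × ℤ → ℤ × ℤ := fun p ↦ (p.1 + p.2, p.1 - p.2)
  have hf : Function.Injective f := by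
    rintro ⟨a, b⟩ ⟨c, d⟩ h
    simp only [f, Prod.mk.injEq] at h ⊢
    omega
  have hg : Function.Injective g := by
    rintro ⟨a, b⟩ ⟨c, d⟩ h
    simp only [g, Prod.mk.injEq] at h ⊢
    omega
  have hfg : IsCompl (Set.range f) (Set.range g) := by
    rw [isCompl_iff, Set.disjoint_iff_forall_ne, codisjoint_iff]
    refine ⟨?_, Set.eq_univ_iff_forall.2 ?_⟩
    · rintro _ ⟨⟨a, b⟩, rfl⟩ _ ⟨⟨c, d⟩, rfl⟩ h
      simp only [f, g, Prod.mk.injEq] at h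
      omega
    · rintro ⟨j, k⟩
      rcases Int.even_or_odd' (j + k) with ⟨m, hm | hm⟩
      · exact Or.inr ⟨(m, j - m), by simp only [g, Prod.mk.injEq]; omega⟩
      · exact Or.inl ⟨(m + 1, j - m - 1), by simp only [f, Prod.mk.injEq]; omega⟩
  have hFf : HasSum (F ∘ f) (-(thetaThreeSq L (x + y) * thetaTwoSq L (x - y))) := by
    have hs := summable_mul_of_summable_norm (summable_thetaThreeSq hL (x + y)).norm
      (summable_thetaTwoSq hL (x - y)).norm
    have h := ((summable_thetaThreeSq hL (x + y)).hasSum.mul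
      (summable_thetaTwoSq hL (x - y)).hasSum hs).neg
    refine h.congr_fun ?_
    rintro ⟨r, s⟩
    have hsign : (-1 : ℂ) ^ (r + s) * (-1 : ℂ) ^ (r - s - 1) = -1 := by
      rw [← zpow_add₀ (by norm_num), show r + s + (r - s - 1) = 2 * (r - 1) + 1 by ring]
      exact Odd.neg_one_zpow ⟨_, rfl⟩
    simp only [Function.comp, F, t, f]
    rw [mul_mul_mul_comm, hsign, ← Complex.exp_add, ← Complex.exp_add, neg_one_mul]
    congr 2
    push_cast
    ring
  have hFg : HasSum (F ∘ g) (thetaTwoSq L (x + y) * thetaThreeSq L (x - y)) := by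
    have hs := summable_mul_of_summable_norm (summable_thetaTwoSq hL (x + y)).norm
      (summable_thetaThreeSq hL (x - y)).norm
    refine ((summable_thetaTwoSq hL (x + y)).hasSum.mul
      (summable_thetaThreeSq hL (x - y)).hasSum hs).congr_fun ?_
    rintro ⟨s, r⟩
    have hsign : (-1 : ℂ) ^ (s + r) * (-1 : ℂ) ^ (s - r) = 1 := by
      rw [← zpow_add₀ (by norm_num), show s + r + (s - r) = 2 * s by ring]
      exact Even.neg_one_zpow (even_two_mul s)
    simp only [Function.comp, F, t, g]
    rw [mul_mul_mul_comm, hsign, ← Complex.exp_add, ← Complex.exp_add, one_mul]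
    congr 1
    push_cast
    ring
  have hF := HasSum.add_isCompl hfg (hf.hasSum_range_iff.2 hFf) (hg.hasSum_range_iff.2 hFg)
  have hprod := tsum_mul_tsum_of_summable_norm (summable_norm_thetaOne hL x)
    (summable_norm_thetaOne hL y)
  have hsum : (∑' j, t x j) * ∑' k, t y k = _ := hprod.trans hF.tsum_eq
  linear_combination ((∑' j, t x j) * ∑' k, t y k) * Complex.I_sq - hsum

lemma thetaThreeSq_add_pi (L : ℝ) (x : ℂ) :
    thetaThreeSq L (x + Real.pi) = thetaThreeSq L x := by
  refine tsum_congr fun r ↦ Complex.exp_eq_exp_iff_exists_int.2 ⟨r, ?_⟩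
  ring

lemma cexp_odd_mul_pi_mul_I (j : ℤ) :
    Complex.exp ((2 * j + 1) * Complex.I * Real.pi) = -1 := by
  rw [← Complex.exp_pi_mul_I]
  refine Complex.exp_eq_exp_iff_exists_int.2 ⟨j, ?_⟩
  ring

lemma thetaTwoSq_add_pi (L : ℝ) (x : ℂ) :
    thetaTwoSq L (x + Real.pi) = -thetaTwoSq L x := by
  rw [thetaTwoSq, thetaTwoSq, ← tsum_neg]
  refine tsum_congr fun s ↦ ?_
  rw [mul_add, ← add_assoc, Complex.exp_add, cexp_odd_mul_pi_mul_I, mul_neg_one]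

lemma thetaTwoSq_neg (L : ℝ) (x : ℂ) : thetaTwoSq L (-x) = thetaTwoSq L x := by
  rw [thetaTwoSq, thetaTwoSq, ← (Equiv.subLeft (-1 : ℤ)).tsum_eq]
  refine tsum_congr fun s ↦ ?_
  rw [Equiv.subLeft_apply]
  congr 1
  push_cast
  ring

lemma thetaTwoSq_pi_div_two (L : ℝ) : thetaTwoSq L (Real.pi / 2) = 0 := by
  have h := thetaTwoSq_add_pi L (-(Real.pi / 2))
  rw [thetaTwoSq_neg, show -((Real.pi : ℂ) / 2) + Real.pi = Real.pi / 2 by ring] at h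
  exact self_eq_neg.1 h

lemma th1_add_pi {q : ℝ} (hq : 0 < q) (x : ℂ) : th1 q (x + Real.pi) = -th1 q x := by
  rw [th1_eq_tsum_cexp hq, th1_eq_tsum_cexp hq, ← mul_neg, ← tsum_neg]
  congr 1
  refine tsum_congr fun j ↦ ?_
  rw [mul_add, ← add_assoc, Complex.exp_add, cexp_odd_mul_pi_mul_I]
  ring

lemma th1_pi_div_two_ne_zero {q : ℝ} (hq : 0 < q) (hq1 : q < 1) :
    th1 q (Real.pi / 2) ≠ 0 := by
  have hL : Real.log q < 0 := Real.log_neg hq hq1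
  have hterm (j : ℤ) : (-1 : ℂ) ^ j * Complex.exp (Real.log q * ((j : ℂ) + 1 / 2) ^ 2 +
      (2 * j + 1) * Complex.I * (Real.pi / 2)) =
      Complex.I * (Real.exp (Real.log q * ((j : ℝ) + 1 / 2) ^ 2) : ℝ) := by
    have h1 : Complex.exp ((2 * j + 1) * Complex.I * (Real.pi / 2)) = (-1) ^ j * Complex.I := by
      rw [show (2 * (j : ℂ) + 1) * Complex.I * (Real.pi / 2) =
          j * (Real.pi * Complex.I) + Real.pi / 2 * Complex.I by ring, Complex.exp_add,
        Complex.exp_int_mul, Complex.exp_pi_mul_I, Complex.exp_pi_div_two_mul_I]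
    have h2 : (-1 : ℂ) ^ j * (-1) ^ j = 1 := by
      rw [← mul_zpow]
      norm_num
    rw [Complex.exp_add, h1]
    push_cast
    linear_combination Complex.exp (Real.log q * ((j : ℂ) + 1 / 2) ^ 2) * Complex.I * h2
  have hsum : Summable fun j : ℤ ↦ Real.exp (Real.log q * ((j : ℝ) + 1 / 2) ^ 2) := by
    refine (summable_norm_thetaOne hL (Real.pi / 2)).congr fun j ↦ ?_
    rw [hterm, norm_mul, Complex.norm_I, one_mul, Complex.norm_real, Real.norm_eq_abs,
      Real.abs_exp]
  have hpos := hsum.tsum_pos (fun j ↦ (Real.exp_pos _).le) 0 (Real.exp_pos _)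
  rw [th1_eq_tsum_cexp hq, tsum_congr hterm, tsum_mul_left, ← Complex.ofReal_tsum]
  exact mul_ne_zero (neg_ne_zero.2 Complex.I_ne_zero)
    (mul_ne_zero Complex.I_ne_zero (Complex.ofReal_ne_zero.2 hpos.ne'))

/-- the total excitation energy of an exact 4-string `u, u+θ, u+2θ, u+3θ`
(with `θ = π/4`) equals `−4`, independently of the string centre `u`, provided
`θ₁(u+jθ) ≠ 0` for `j = −1, 0, 1, 2, 3`. -/
theorem stmt12 (q : ℝ) (hq : 0 < q) (hq1 : q < 1) (u : ℂ)
    (hm1 : th1 (q : ℂ) (u - thet) ≠ 0)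
    (h0 : th1 (q : ℂ) u ≠ 0)
    (h1 : th1 (q : ℂ) (u + thet) ≠ 0)
    (h2 : th1 (q : ℂ) (u + 2 * thet) ≠ 0)
    (h3 : th1 (q : ℂ) (u + 3 * thet) ≠ 0) :
    eps (q : ℂ) u + eps (q : ℂ) (u + thet) + eps (q : ℂ) (u + 2 * thet) +
      eps (q : ℂ) (u + 3 * thet) = -4 := by
  have hm : th1 q (u - thet) = -th1 q (u + 3 * thet) := by
    rw [show u + 3 * thet = u - thet + Real.pi by rw [thet]; ring, th1_add_pi hq, neg_neg]
  have h4 : th1 q (u + 3 * thet + thet) = -th1 q u := by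
    rw [show u + 3 * thet + thet = u + Real.pi by rw [thet]; ring, th1_add_pi hq]
  have hP := th1_mul_th1 hq hq1
  have hA := thetaThreeSq_add_pi (Real.log q)
  have hB := thetaTwoSq_add_pi (Real.log q)
  have hB0 := thetaTwoSq_pi_div_two (Real.log q)
  have hne : th1 q (2 * thet) ≠ 0 := by
    rw [show 2 * thet = (Real.pi : ℂ) / 2 by rw [thet]; ring]
    exact th1_pi_div_two_ne_zero hq hq1
  have haa := hP u u
  have hbb := hP (u + thet) (u + thet)
  have hcc := hP (u + 2 * thet) (u + 2 * thet)
  have hdd := hP (u + 3 * thet) (u + 3 * thet)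
  have hac := hP (u + 2 * thet) u
  have hbd := hP (u + 3 * thet) (u + thet)
  have hθ := hP thet thet
  have hθ2 := hP (2 * thet) (2 * thet)
  rw [sub_self, ← two_mul] at haa
  rw [sub_self, show u + thet + (u + thet) = 2 * u + Real.pi / 2 by rw [thet]; ring] at hbb
  rw [sub_self, show u + 2 * thet + (u + 2 * thet) = 2 * u + Real.pi by rw [thet]; ring,
    hA, hB] at hcc
  rw [sub_self, show u + 3 * thet + (u + 3 * thet) = 2 * u + Real.pi / 2 + Real.pi by
    rw [thet]; ring, hA, hB] at hdd
  rw [show u + 2 * thet + u = 2 * u + Real.pi / 2 by rw [thet]; ring,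
    show u + 2 * thet - u = Real.pi / 2 by rw [thet]; ring, hB0] at hac
  rw [show u + 3 * thet + (u + thet) = 2 * u + Real.pi by rw [thet]; ring,
    show u + 3 * thet - (u + thet) = Real.pi / 2 by rw [thet]; ring, hB, hB0] at hbd
  rw [sub_self, show thet + thet = Real.pi / 2 by rw [thet]; ring, hB0] at hθ
  rw [sub_self, show 2 * thet + 2 * thet = 0 + Real.pi by rw [thet]; ring, hA, hB] at hθ2
  simp only [eps]
  rw [hm, h4, show u + thet - thet = u by ring, show u + thet + thet = u + 2 * thet by ring,
    show u + 2 * thet - thet = u + thet by ring,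
    show u + 2 * thet + thet = u + 3 * thet by ring,
    show u + 3 * thet - thet = u + 2 * thet by ring]
  generalize th1 q u = a at *
  generalize th1 q (u + thet) = b at *
  generalize th1 q (u + 2 * thet) = c at *
  generalize th1 q (u + 3 * thet) = d at *
  generalize th1 q thet = s at *
  generalize th1 q (2 * thet) = t at *
  generalize thetaThreeSq (Real.log q) (2 * u) = A at *
  generalize thetaTwoSq (Real.log q) (2 * u) = B at *
  generalize thetaThreeSq (Real.log q) (2 * u + Real.pi / 2) = A' at *
  generalize thetaTwoSq (Real.log q) (2 * u + Real.pi / 2) = B' at *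
  generalize thetaThreeSq (Real.log q) (Real.pi / 2) = T4 at *
  generalize thetaThreeSq (Real.log q) 0 = T3 at *
  generalize thetaTwoSq (Real.log q) 0 = T2 at *
  have hac2 : a ^ 2 - c ^ 2 = -2 * T3 * B := by linear_combination haa - hcc
  have hbd2 : d ^ 2 - b ^ 2 = 2 * T3 * B' := by linear_combination hdd - hbb
  have hT : 2 * s ^ 2 * T3 = T4 * t ^ 2 := by linear_combination 2 * T3 * hθ - T4 * hθ2
  have key : s ^ 2 * ((a ^ 2 - c ^ 2) * (c * a) + (d ^ 2 - b ^ 2) * (d * b)) =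
      -2 * t ^ 2 * ((c * a) * (d * b)) := by
    rw [hac2, hbd2, hac, hbd]
    linear_combination 2 * B * B' * T4 * hT
  field_simp
  linear_combination 2 * key
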